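/- arXiv:1902.06869 — 2 statements merged into one kernel-verified Lean document; each statement's English description precedes it below -/
import Mathlib

section
/- Let σ > 0, 0 < ρ < 1, m > 0, K > 0, and γ ≥ 0. Then the marginal CDF of R₂, given by F_{R₂}(γ) = ∫₀^γ ∫₀^∞ f(r₁,r₂) dr₁ dr₂, equals the convergent series ∑_{k=0}^∞ ∑_{i=0}^{k} ∑_{n=0}^{i} ∑_{j=0}^∞ α(k,i,n) G(j,i−n,n,γ). -/
open MeasureTheory

/-- Pochhammer symbol (ascending factorial) `(m)_k = m (m+1) ⋯ (m+k-1)`. -/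
noncomputable def poch (m : ℝ) (k : ℕ) : ℝ := ∏ j ∈ Finset.range k, (m + j)

/-- Modified Bessel function of the first kind of order zero,
`I₀(y) = ∑ (y/2)^{2n} / (n!)²`. -/
noncomputable def I0 (y : ℝ) : ℝ := ∑' n : ℕ, (y / 2) ^ (2 * n) / (Nat.factorial n : ℝ) ^ 2

/-- Confluent hypergeometric function `₁F₁(m, 1; z) = ∑ (m)_n zⁿ / (n!)²`. -/
noncomputable def F11 (m z : ℝ) : ℝ := ∑' n : ℕ, poch m n * z ^ n / (Nat.factorial n : ℝ) ^ 2

/-- Series coefficient `α(k,i,n)` of the bivariate Rician shadowed joint PDF. -/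
noncomputable def alpha (σ ρ m K : ℝ) (k i n : ℕ) : ℝ :=
  (8 * Real.rpow (m * ρ / (m * ρ + K)) m / (σ ^ 6 * ρ * (1 - ρ) ^ 2)) *
  (poch m (k - i) * (K / (σ ^ 2 * ρ * (ρ * m + K))) ^ (k - i) /
    (Nat.factorial (k - i) : ℝ) ^ 2) *
  (1 / ((Nat.factorial n : ℝ) ^ 2 * (Nat.factorial (i - n) : ℝ) ^ 2 *
    (σ ^ 2 * (1 - ρ)) ^ (2 * i))) *
  ((Nat.factorial k : ℝ) / (2 * ((1 + ρ) / (σ ^ 2 * ρ * (1 - ρ))) ^ (k + 1)))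

/-- Closed-form power series of the bivariate Rician shadowed joint PDF. -/
noncomputable def fpdf (σ ρ m K r₁ r₂ : ℝ) : ℝ :=
  ∑' k : ℕ, ∑ i ∈ Finset.range (k + 1), ∑ n ∈ Finset.range (i + 1),
    alpha σ ρ m K k i n * r₁ ^ (2 * n + 1) * r₂ ^ (2 * (i - n) + 1) *
      Real.exp (-(r₁ ^ 2 + r₂ ^ 2) / (σ ^ 2 * (1 - ρ)))

/-- `G(j,l,q,γ) = (−1)^j γ^{2(l+j+1)} q! (σ²(1−ρ))^{q+1−j} / (j!·4(l+j+1))`. -/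
noncomputable def Gfun (σ ρ : ℝ) (j l q : ℕ) (γ : ℝ) : ℝ :=
  (-1 : ℝ) ^ j * γ ^ (2 * (l + j + 1)) * (Nat.factorial q : ℝ) *
    (σ ^ 2 * (1 - ρ)) ^ ((q : ℤ) + 1 - (j : ℤ)) /
    ((Nat.factorial j : ℝ) * (4 * (l + j + 1)))

/-- `Ḡ(λ,k)`, the `(2(k+1))`-th moment of the BPP distance distribution. -/
noncomputable def Gbar (Dalt ra lam : ℝ) (k : ℕ) : ℝ :=
  ((Dalt ^ 2 + lam ^ 2 + ra ^ 2) ^ (k + 2) - (Dalt ^ 2 + lam ^ 2) ^ (k + 2)) /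
    (ra ^ 2 * (k + 2))


lemma aux_poch_pos {m : ℝ} (hm : 0 < m) (k : ℕ) : 0 < poch m k := by
  unfold poch
  exact Finset.prod_pos fun j _ => by positivity

lemma aux_summable_w {m z : ℝ} (hm : 0 < m) (hz : 0 < z) (hz1 : z < 1) :
    Summable (fun p : ℕ => poch m p / (p.factorial : ℝ) * z ^ p) := by
  apply summable_of_ratio_test_tendsto_lt_one hz1
  · filter_upwards with n
    have := aux_poch_pos hm n
    positivity
  · have h1 : Filter.Tendsto (fun n : ℕ => (1 + (m - 1) / ((n : ℝ) + 1)) * z) Filter.atTop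
        (nhds ((1 + 0) * z)) := by
      refine Filter.Tendsto.mul_const _ (Filter.Tendsto.const_add _ ?_)
      have := (tendsto_one_div_add_atTop_nhds_zero_nat (𝕜 := ℝ)).const_mul (m - 1)
      simpa [div_eq_mul_inv] using this
    rw [add_zero, one_mul] at h1
    refine h1.congr fun n => ?_
    have hp := aux_poch_pos hm n
    have hp1 := aux_poch_pos hm (n + 1)
    have e : poch m (n + 1) = poch m n * (m + n) := by
      unfold poch; rw [Finset.prod_range_succ]
    rw [Real.norm_of_nonneg (by positivity), Real.norm_of_nonneg (by positivity), e,
      Nat.factorial_succ]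
    push_cast
    field_simp
    ring

lemma aux_summable_2 {m x y : ℝ} (hm : 0 < m) (hx : 0 < x) (hx1 : x < 1) (hy : 0 < y)
    (hxy : x + y < 1) :
    Summable (fun k : ℕ => ∑ i ∈ Finset.range (k + 1),
      (k.choose i : ℝ) * (poch m (k - i) / ((k - i).factorial : ℝ)) * y ^ (k - i) * x ^ i) := by
  have hp := fun k => aux_poch_pos hm k
  have h1 : Summable (fun q : ℕ × ℕ => ((q.2 + q.1).choose q.1 : ℝ) * x ^ q.2 *
      (poch m q.1 / (q.1.factorial : ℝ) * y ^ q.1)) := by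
    rw [summable_prod_of_nonneg]
    · have hn : ‖x‖ < 1 := by rwa [Real.norm_of_nonneg hx.le]
      constructor
      · intro p
        have h0 : Summable (fun i : ℕ => ((i + p).choose p : ℝ) * x ^ i) :=
          summable_choose_mul_geometric_of_norm_lt_one p hn
        exact h0.mul_right (poch m p / (p.factorial : ℝ) * y ^ p)
      · have : (fun p : ℕ => ∑' i : ℕ, ((i + p).choose p : ℝ) * x ^ i *
            (poch m p / (p.factorial : ℝ) * y ^ p)) = fun p : ℕ =>
            (1 / (1 - x)) * (poch m p / (p.factorial : ℝ) * (y / (1 - x)) ^ p) := by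
          funext p
          rw [tsum_mul_right, tsum_choose_mul_geometric_of_norm_lt_one p hn]
          have : 1 - x ≠ 0 := by linarith
          rw [div_pow]
          field_simp
          ring
        simp only []
        rw [this]
        refine (aux_summable_w hm (div_pos hy (by linarith)) ?_).mul_left _
        rw [div_lt_one (by linarith)]; linarith
    · intro q
      have := hp q.1
      simp only [Pi.zero_apply]
      positivity
  have h2 := (Finset.HasAntidiagonal.sigmaAntidiagonalEquivProd (A := ℕ)).summable_iff.mpr h1
  have h3 := h2.sigma
  refine h3.congr fun k => ?_
  simp only [Function.comp_apply, Finset.HasAntidiagonal.sigmaAntidiagonalEquivProd_apply]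
  rw [tsum_fintype, Finset.sum_coe_sort (Finset.HasAntidiagonal.antidiagonal k) (fun q : ℕ × ℕ => ((q.2 + q.1).choose q.1 : ℝ) * x ^ q.2 *
      (poch m q.1 / (q.1.factorial : ℝ) * y ^ q.1)), ← Finset.Nat.sum_antidiagonal_swap]
  simp only [Prod.fst_swap, Prod.snd_swap]
  rw [Finset.Nat.sum_antidiagonal_eq_sum_range_succ (fun a b : ℕ => ((a + b).choose b : ℝ) * x ^ a *
      (poch m b / (b.factorial : ℝ) * y ^ b))]
  refine Finset.sum_congr rfl fun i hi => ?_
  have hi' : i ≤ k := by simpa [Nat.lt_succ_iff] using hi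
  rw [Nat.add_sub_cancel' hi', Nat.choose_symm hi']
  ring

lemma aux_alpha_nonneg (σ ρ m K : ℝ) (k i n : ℕ)
    (hσ : 0 < σ) (hρ0 : 0 < ρ) (hρ1 : ρ < 1) (hm : 0 < m) (hK : 0 < K) :
    0 ≤ alpha σ ρ m K k i n := by
  unfold alpha
  have h1 : 0 < 1 - ρ := by linarith
  have := aux_poch_pos hm (k - i)
  have : 0 ≤ Real.rpow (m * ρ / (m * ρ + K)) m := Real.rpow_nonneg (by positivity) _
  positivity

lemma aux_alg (C P a b c : ℝ) (hb : 0 < b) (hc : 0 < c) (k i n : ℕ) (hi : i ≤ k) (hn : n ≤ i) :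
    C * (P * a ^ (k - i) / ((k - i).factorial : ℝ) ^ 2) *
      (1 / ((n.factorial : ℝ) ^ 2 * ((i - n).factorial : ℝ) ^ 2 * c ^ (2 * i))) *
      ((k.factorial : ℝ) / (2 * b ^ (k + 1))) *
      ((n.factorial : ℝ) * ((i - n).factorial : ℝ) * c ^ i) =
    (C / (2 * b)) * ((k.choose i : ℝ) * (P / ((k - i).factorial : ℝ)) * (a / b) ^ (k - i) *
      (1 / (c * b)) ^ i) * (i.choose n : ℝ) := by
  rw [Nat.cast_choose ℝ hi, Nat.cast_choose ℝ hn]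
  obtain ⟨p, rfl⟩ := Nat.exists_eq_add_of_le hi
  rw [Nat.add_sub_cancel_left]
  rw [div_pow, div_pow, one_pow, mul_pow]
  have := Nat.factorial_pos
  field_simp
  ring

lemma aux_summable_S (σ ρ m K : ℝ)
    (hσ : 0 < σ) (hρ0 : 0 < ρ) (hρ1 : ρ < 1) (hm : 0 < m) (hK : 0 < K) :
    Summable (fun k : ℕ => ∑ i ∈ Finset.range (k + 1), ∑ n ∈ Finset.range (i + 1),
      alpha σ ρ m K k i n * ((n.factorial : ℝ) * ((i - n).factorial : ℝ) *
        (σ ^ 2 * (1 - ρ)) ^ i)) := by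
  have h1 : 0 < 1 - ρ := by linarith
  set C := (8 * Real.rpow (m * ρ / (m * ρ + K)) m / (σ ^ 6 * ρ * (1 - ρ) ^ 2)) with hC
  set a := K / (σ ^ 2 * ρ * (ρ * m + K)) with ha
  set b := (1 + ρ) / (σ ^ 2 * ρ * (1 - ρ)) with hb
  set c := σ ^ 2 * (1 - ρ) with hc
  have ha0 : 0 < a := by positivity
  have hb0 : 0 < b := by positivity
  have hc0 : 0 < c := by positivity
  have ex : 2 / (c * b) = 2 * ρ / (1 + ρ) := by
    rw [hc, hb]; field_simp
  have ey : a / b = (K / (ρ * m + K)) * ((1 - ρ) / (1 + ρ)) := by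
    rw [ha, hb]; field_simp
  have hx1 : 2 / (c * b) < 1 := by
    rw [ex, div_lt_one (by positivity)]; linarith
  have hxy : 2 / (c * b) + a / b < 1 := by
    have t : K / (ρ * m + K) < 1 := by
      rw [div_lt_one (by positivity)]; nlinarith [mul_pos hρ0 hm]
    have t2 : 0 < (1 - ρ) / (1 + ρ) := by positivity
    have t3 : 2 * ρ / (1 + ρ) + (1 - ρ) / (1 + ρ) = 1 := by field_simp; ring
    rw [ex, ey]
    nlinarith
  have := (aux_summable_2 hm (x := 2 / (c * b)) (y := a / b) (by positivity) hx1 (by positivity)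
    hxy).mul_left (C / (2 * b))
  refine this.congr fun k => ?_
  rw [Finset.mul_sum]
  refine Finset.sum_congr rfl fun i hi => ?_
  have hi' : i ≤ k := by simpa [Nat.lt_succ_iff] using hi
  symm
  have key : ∀ n ∈ Finset.range (i + 1), alpha σ ρ m K k i n *
      ((n.factorial : ℝ) * ((i - n).factorial : ℝ) * c ^ i) =
      (C / (2 * b)) * ((k.choose i : ℝ) * (poch m (k - i) / ((k - i).factorial : ℝ)) *
        (a / b) ^ (k - i) * (1 / (c * b)) ^ i) * (i.choose n : ℝ) := by
    intro n hn
    exact aux_alg C (poch m (k - i)) a b c hb0 hc0 k i n hi'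
      (by simpa [Nat.lt_succ_iff] using hn)
  rw [Finset.sum_congr rfl key, ← Finset.mul_sum]
  have : (∑ n ∈ Finset.range (i + 1), (i.choose n : ℝ)) = 2 ^ i := by
    exact_mod_cast Nat.sum_range_choose i
  rw [this, show (2 : ℝ) / (c * b) = 1 / (c * b) * 2 by ring, mul_pow (1 / (c * b))]
  ring

lemma aux_gauss_int {c : ℝ} (hc : 0 < c) (n : ℕ) :
    IntegrableOn (fun r : ℝ => r ^ (2 * n + 1) * Real.exp (-r ^ 2 / c)) (Set.Ioi 0) := by
  have := integrableOn_rpow_mul_exp_neg_mul_sq (b := 1 / c) (by positivity)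
    (s := ((2 * n + 1 : ℕ) : ℝ)) (by push_cast; linarith [(Nat.cast_nonneg n : (0 : ℝ) ≤ n)])
  refine this.congr_fun (fun x _ => ?_) measurableSet_Ioi
  simp only [Real.rpow_natCast]
  congr 2; ring

lemma aux_gauss_val {c : ℝ} (hc : 0 < c) (n : ℕ) :
    ∫ r in Set.Ioi (0 : ℝ), r ^ (2 * n + 1) * Real.exp (-r ^ 2 / c) =
      (n.factorial : ℝ) * c ^ (n + 1) / 2 := by
  have := integral_rpow_mul_exp_neg_mul_rpow (p := 2) (b := 1 / c) (by norm_num)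
    (q := ((2 * n + 1 : ℕ) : ℝ)) (by push_cast; linarith [(Nat.cast_nonneg n : (0 : ℝ) ≤ n)])
    (by positivity)
  rw [show -(((2 * n + 1 : ℕ) : ℝ) + 1) / 2 = -((n + 1 : ℕ) : ℝ) by push_cast; ring,
    show (((2 * n + 1 : ℕ) : ℝ) + 1) / 2 = (n : ℝ) + 1 by push_cast; ring,
    Real.Gamma_nat_eq_factorial, Real.rpow_neg (by positivity), Real.rpow_natCast] at this
  rw [show (n.factorial : ℝ) * c ^ (n + 1) / 2 =
    ((1 / c) ^ (n + 1))⁻¹ * (1 / 2) * (n.factorial : ℝ) by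
      rw [one_div, inv_pow, inv_inv]; ring, ← this]
  refine setIntegral_congr_fun measurableSet_Ioi fun x _ => ?_
  have e : x ^ (2 : ℝ) = x ^ 2 := by exact_mod_cast Real.rpow_natCast x 2
  simp only [Real.rpow_natCast, e]
  congr 2; ring

lemma aux_bound {c : ℝ} (hc : 0 < c) (l : ℕ) {r : ℝ} (hr : 0 ≤ r) :
    r ^ (2 * l + 1) * Real.exp (-r ^ 2 / c) ≤ (l.factorial : ℝ) * c ^ l * r := by
  have h := Real.pow_div_factorial_le_exp (r ^ 2 / c) (by positivity) l
  have hf : (0 : ℝ) < l.factorial := by exact_mod_cast Nat.factorial_pos l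
  rw [div_le_iff₀ hf, div_pow, div_le_iff₀ (by positivity)] at h
  have e : Real.exp (r ^ 2 / c) * Real.exp (-r ^ 2 / c) = 1 := by
    rw [← Real.exp_add]; simp [neg_div]
  calc r ^ (2 * l + 1) * Real.exp (-r ^ 2 / c)
      = ((r ^ 2) ^ l) * (r * Real.exp (-r ^ 2 / c)) := by ring
    _ ≤ (Real.exp (r ^ 2 / c) * l.factorial * c ^ l) * (r * Real.exp (-r ^ 2 / c)) := by
        gcongr
    _ = (l.factorial : ℝ) * c ^ l * r * (Real.exp (r ^ 2 / c) * Real.exp (-r ^ 2 / c)) := by ring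
    _ = _ := by rw [e, mul_one]

lemma aux_inc {c : ℝ} (hc : 0 < c) (l : ℕ) {γ : ℝ} (hγ : 0 ≤ γ) :
    HasSum (fun j : ℕ => (-1 : ℝ) ^ j / (c ^ j * (j.factorial : ℝ)) *
        (γ ^ (2 * (l + j + 1)) / (2 * (l + j + 1))))
      (∫ r in (0 : ℝ)..γ, r ^ (2 * l + 1) * Real.exp (-r ^ 2 / c)) := by
  have hs : Summable (fun j : ℕ => γ ^ (2 * l + 1) * ((γ ^ 2 / c) ^ j / (j.factorial : ℝ))) :=
    (Real.summable_pow_div_factorial _).mul_left _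
  have := intervalIntegral.hasSum_integral_of_dominated_convergence (a := 0) (b := γ)
    (μ := volume)
    (F := fun (j : ℕ) (r : ℝ) => r ^ (2 * l + 1) * ((-r ^ 2 / c) ^ j / (j.factorial : ℝ)))
    (f := fun r : ℝ => r ^ (2 * l + 1) * Real.exp (-r ^ 2 / c))
    (fun j _ => γ ^ (2 * l + 1) * ((γ ^ 2 / c) ^ j / (j.factorial : ℝ)))
    (fun j => by
      apply Continuous.aestronglyMeasurable
      fun_prop)
    (fun j => by
      filter_upwards with t ht
      rw [Set.uIoc_of_le hγ] at ht
      have h0 := ht.1.le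
      have h1 := ht.2
      rw [norm_mul, norm_div, norm_pow, norm_pow, norm_div, norm_neg, norm_pow,
        Real.norm_of_nonneg h0, Real.norm_of_nonneg hc.le, Real.norm_natCast]
      gcongr)
    (by filter_upwards with t ht using hs)
    (by simp)
    (by
      filter_upwards with t ht
      refine HasSum.mul_left _ ?_
      rw [Real.exp_eq_exp_ℝ]
      exact NormedSpace.expSeries_div_hasSum_exp _)
  suffices hE : (fun j : ℕ => (-1 : ℝ) ^ j / (c ^ j * (j.factorial : ℝ)) *
        (γ ^ (2 * (l + j + 1)) / (2 * (l + j + 1)))) = fun j : ℕ =>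
      ∫ r in (0 : ℝ)..γ, r ^ (2 * l + 1) * ((-r ^ 2 / c) ^ j / (j.factorial : ℝ)) by
    rw [hE]; exact this
  funext j
  have e : ∀ r : ℝ, r ^ (2 * l + 1) * ((-r ^ 2 / c) ^ j / (j.factorial : ℝ)) =
      (-1 : ℝ) ^ j / (c ^ j * (j.factorial : ℝ)) * r ^ (2 * l + 1 + 2 * j) := by
    intro r
    rw [div_pow, neg_pow, pow_add r (2 * l + 1), pow_mul r 2 j]
    field_simp
  simp only [e]
  rw [intervalIntegral.integral_const_mul, integral_pow]
  congr 1
  rw [show 2 * l + 1 + 2 * j + 1 = 2 * (l + j + 1) by ring]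
  rw [zero_pow (by omega), sub_zero]
  congr 1
  push_cast; ring

lemma aux_G {c : ℝ} (hc : 0 < c) (l q j : ℕ) (γ : ℝ) :
    (-1 : ℝ) ^ j * γ ^ (2 * (l + j + 1)) * (Nat.factorial q : ℝ) *
      c ^ ((q : ℤ) + 1 - (j : ℤ)) / ((Nat.factorial j : ℝ) * (4 * (l + j + 1))) =
    ((q.factorial : ℝ) * c ^ (q + 1) / 2) * ((-1 : ℝ) ^ j / (c ^ j * (j.factorial : ℝ)) *
        (γ ^ (2 * (l + j + 1)) / (2 * (l + j + 1)))) := by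
  rw [zpow_sub₀ hc.ne', show (q : ℤ) + 1 = ((q + 1 : ℕ) : ℤ) by push_cast; rfl, zpow_natCast,
    zpow_natCast]
  have : (l : ℝ) + j + 1 ≠ 0 := by positivity
  have : (j.factorial : ℝ) ≠ 0 := by positivity
  field_simp
  norm_num

theorem marginal_cdf_R2_series (σ ρ m K γ : ℝ)
    (hσ : 0 < σ) (hρ0 : 0 < ρ) (hρ1 : ρ < 1) (hm : 0 < m) (hK : 0 < K) (hγ : 0 ≤ γ) :
    Summable (fun k : ℕ => ∑ i ∈ Finset.range (k + 1), ∑ n ∈ Finset.range (i + 1),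
      ∑' j : ℕ, alpha σ ρ m K k i n * Gfun σ ρ j (i - n) n γ) ∧
    (∫ r₂ in (0 : ℝ)..γ, ∫ r₁ in Set.Ioi (0 : ℝ), fpdf σ ρ m K r₁ r₂) =
      ∑' k : ℕ, ∑ i ∈ Finset.range (k + 1), ∑ n ∈ Finset.range (i + 1),
        ∑' j : ℕ, alpha σ ρ m K k i n * Gfun σ ρ j (i - n) n γ := by
  have h1 : 0 < 1 - ρ := by linarith
  have hc0 : 0 < σ ^ 2 * (1 - ρ) := by positivity
  have hA := fun k i n => aux_alpha_nonneg σ ρ m K k i n hσ hρ0 hρ1 hm hK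
  have hS := aux_summable_S σ ρ m K hσ hρ0 hρ1 hm hK
  have hterm : ∀ k i n : ℕ, ∑' j : ℕ, alpha σ ρ m K k i n * Gfun σ ρ j (i - n) n γ =
      alpha σ ρ m K k i n * ((n.factorial : ℝ) * (σ ^ 2 * (1 - ρ)) ^ (n + 1) / 2) *
      ∫ r in (0 : ℝ)..γ, r ^ (2 * (i - n) + 1) * Real.exp (-r ^ 2 / (σ ^ 2 * (1 - ρ))) := by
    intro k i n
    have h := ((aux_inc hc0 (i - n) hγ).mul_left
      (alpha σ ρ m K k i n * ((n.factorial : ℝ) * (σ ^ 2 * (1 - ρ)) ^ (n + 1) / 2))).tsum_eq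
    rw [← h]
    refine tsum_congr fun j => ?_
    unfold Gfun
    rw [aux_G hc0]
    ring
  simp only [hterm]
  unfold fpdf
  generalize σ ^ 2 * (1 - ρ) = c at *
  generalize alpha σ ρ m K = A at *
  clear hterm
  have hexp : ∀ r₁ r₂ : ℝ, Real.exp (-(r₁ ^ 2 + r₂ ^ 2) / c) =
      Real.exp (-r₁ ^ 2 / c) * Real.exp (-r₂ ^ 2 / c) := by
    intro r₁ r₂
    rw [← Real.exp_add]; congr 1; ring
  set S : ℕ → ℝ := fun k => ∑ i ∈ Finset.range (k + 1), ∑ n ∈ Finset.range (i + 1),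
      A k i n * ((n.factorial : ℝ) * ((i - n).factorial : ℝ) * c ^ i) with hSdef
  set H : ℕ → ℝ → ℝ := fun k r => ∑ i ∈ Finset.range (k + 1), ∑ n ∈ Finset.range (i + 1),
      A k i n * ((n.factorial : ℝ) * c ^ (n + 1) / 2) *
        (r ^ (2 * (i - n) + 1) * Real.exp (-r ^ 2 / c)) with hH
  have hH0 : ∀ k r, 0 ≤ r → 0 ≤ H k r := by
    intro k r hr
    refine Finset.sum_nonneg fun i _ => Finset.sum_nonneg fun n _ => ?_
    have := hA k i n
    positivity
  have hHle : ∀ k r, 0 ≤ r → H k r ≤ S k * (c / 2 * r) := by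
    intro k r hr
    rw [hSdef, hH]
    simp only [Finset.sum_mul]
    refine Finset.sum_le_sum fun i _ => Finset.sum_le_sum fun n hn => ?_
    have hn' : n ≤ i := by simpa [Nat.lt_succ_iff] using hn
    have hAn := hA k i n
    calc A k i n * ((n.factorial : ℝ) * c ^ (n + 1) / 2) *
        (r ^ (2 * (i - n) + 1) * Real.exp (-r ^ 2 / c))
        ≤ A k i n * ((n.factorial : ℝ) * c ^ (n + 1) / 2) *
          (((i - n).factorial : ℝ) * c ^ (i - n) * r) := by
          exact mul_le_mul_of_nonneg_left (aux_bound hc0 _ hr) (by positivity)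
      _ = A k i n * ((n.factorial : ℝ) * ((i - n).factorial : ℝ) * (c ^ n * c ^ (i - n))) *
          (c / 2 * r) := by ring
      _ = _ := by rw [← pow_add, Nat.add_sub_cancel' hn']
  have hFint : ∀ (k : ℕ) (r₂ : ℝ), ∀ i ∈ Finset.range (k + 1), ∀ n ∈ Finset.range (i + 1),
      IntegrableOn (fun r₁ : ℝ => A k i n * r₁ ^ (2 * n + 1) * r₂ ^ (2 * (i - n) + 1) *
        Real.exp (-(r₁ ^ 2 + r₂ ^ 2) / c)) (Set.Ioi 0) := by
    intro k r₂ i _ n _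
    have := (aux_gauss_int hc0 n).const_mul
      (A k i n * (r₂ ^ (2 * (i - n) + 1) * Real.exp (-r₂ ^ 2 / c)))
    refine IntegrableOn.congr_fun this (fun x _ => ?_) measurableSet_Ioi
    simp only [hexp]
    ring
  have hFval : ∀ (k : ℕ) (r₂ : ℝ), ∫ r₁ in Set.Ioi (0 : ℝ), (∑ i ∈ Finset.range (k + 1),
      ∑ n ∈ Finset.range (i + 1), A k i n * r₁ ^ (2 * n + 1) * r₂ ^ (2 * (i - n) + 1) *
        Real.exp (-(r₁ ^ 2 + r₂ ^ 2) / c)) = H k r₂ := by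
    intro k r₂
    rw [integral_finsetSum _ fun i hi => integrable_finsetSum _ (hFint k r₂ i hi)]
    refine Finset.sum_congr rfl fun i hi => ?_
    rw [integral_finsetSum _ (hFint k r₂ i hi)]
    refine Finset.sum_congr rfl fun n hn => ?_
    rw [← aux_gauss_val hc0 n, mul_assoc, mul_comm (∫ r in Set.Ioi (0 : ℝ), _), ← mul_assoc,
      ← integral_const_mul]
    refine setIntegral_congr_fun measurableSet_Ioi fun x _ => ?_
    simp only [hexp]
    ring
  have hsumH : ∀ r, 0 ≤ r → Summable fun k => H k r := fun r hr =>
    Summable.of_nonneg_of_le (fun k => hH0 k r hr) (fun k => hHle k r hr) (hS.mul_right _)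
  have hinner : ∀ r₂ : ℝ, 0 ≤ r₂ → HasSum (fun k => H k r₂)
      (∫ r₁ in Set.Ioi (0 : ℝ), ∑' k : ℕ, ∑ i ∈ Finset.range (k + 1),
      ∑ n ∈ Finset.range (i + 1), A k i n * r₁ ^ (2 * n + 1) * r₂ ^ (2 * (i - n) + 1) *
        Real.exp (-(r₁ ^ 2 + r₂ ^ 2) / c)) := by
    intro r₂ hr
    have := hasSum_integral_of_summable_integral_norm (μ := volume.restrict (Set.Ioi (0 : ℝ)))
      (F := fun (k : ℕ) (r₁ : ℝ) => ∑ i ∈ Finset.range (k + 1),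
      ∑ n ∈ Finset.range (i + 1), A k i n * r₁ ^ (2 * n + 1) * r₂ ^ (2 * (i - n) + 1) *
        Real.exp (-(r₁ ^ 2 + r₂ ^ 2) / c))
      (fun k => integrable_finsetSum _ fun i hi => integrable_finsetSum _ (hFint k r₂ i hi))
      (by
        refine (hsumH r₂ hr).congr fun k => ?_
        rw [← hFval k r₂]
        refine setIntegral_congr_fun measurableSet_Ioi fun x hx => ?_
        have hx' : 0 < x := hx
        refine (Real.norm_of_nonneg ?_).symm
        refine Finset.sum_nonneg fun i _ => Finset.sum_nonneg fun n _ => ?_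
        have := hA k i n
        positivity)
    simpa only [hFval] using this
  have hS0 : ∀ k, 0 ≤ S k := by
    intro k
    refine Finset.sum_nonneg fun i _ => Finset.sum_nonneg fun n _ => ?_
    have := hA k i n
    positivity
  have hcont : ∀ l : ℕ, Continuous fun r : ℝ => r ^ (2 * l + 1) * Real.exp (-r ^ 2 / c) := by
    intro l; fun_prop
  have hout := intervalIntegral.hasSum_integral_of_dominated_convergence (a := 0) (b := γ)
    (μ := volume) (F := H)
    (f := fun r₂ => ∫ r₁ in Set.Ioi (0 : ℝ), ∑' k : ℕ, ∑ i ∈ Finset.range (k + 1),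
      ∑ n ∈ Finset.range (i + 1), A k i n * r₁ ^ (2 * n + 1) * r₂ ^ (2 * (i - n) + 1) *
        Real.exp (-(r₁ ^ 2 + r₂ ^ 2) / c))
    (fun k _ => S k * (c / 2 * γ))
    (fun k => by
      apply Continuous.aestronglyMeasurable
      rw [hH]
      fun_prop)
    (fun k => by
      filter_upwards with t ht
      rw [Set.uIoc_of_le hγ] at ht
      rw [Real.norm_of_nonneg (hH0 k t ht.1.le)]
      refine (hHle k t ht.1.le).trans ?_
      have := hS0 k
      have := ht.2
      gcongr)
    (by filter_upwards with t ht using hS.mul_right _)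
    (by simp)
    (by
      filter_upwards with t ht
      rw [Set.uIoc_of_le hγ] at ht
      exact hinner t ht.1.le)
  have hval : (fun k => ∫ r in (0 : ℝ)..γ, H k r) = fun k => ∑ i ∈ Finset.range (k + 1),
      ∑ n ∈ Finset.range (i + 1), A k i n * ((n.factorial : ℝ) * c ^ (n + 1) / 2) *
        ∫ r in (0 : ℝ)..γ, r ^ (2 * (i - n) + 1) * Real.exp (-r ^ 2 / c) := by
    funext k
    rw [hH]
    simp only []
    rw [intervalIntegral.integral_finsetSum]
    · refine Finset.sum_congr rfl fun i _ => ?_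
      rw [intervalIntegral.integral_finsetSum]
      · refine Finset.sum_congr rfl fun n _ => ?_
        rw [intervalIntegral.integral_const_mul]
      · intro n _
        exact ((hcont _).const_mul _).intervalIntegrable _ _
    · intro i _
      exact (continuous_finsetSum _ fun n _ => (hcont _).const_mul _).intervalIntegrable _ _
  rw [hval] at hout
  exact ⟨hout.summable, hout.tsum_eq.symm⟩
end

section
/- Let σ > 0, 0 < ρ < 1, m > 0, K > 0, D_alt > 0, r_a > 0, λ > 0, and γ₂* > 0. Then the NOMA outage probability at UAV-2, Pr(O₂) = ∫_{√(D_alt²+λ²)}^{√(D_alt²+λ²+r_a²)} (2w/r_a²) · [∫₀^{γ₂* w} ∫₀^∞ f(r₁,r₂) dr₁ dr₂] dw, equals the convergent series ∑_{k=0}^∞ ∑_{i=0}^{k} ∑_{n=0}^{i} ∑_{j=0}^∞ α(k,i,n) · G(j,i−n,n,γ₂*) · Ḡ(λ,i−n+j). -/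
open MeasureTheory

theorem swapL (a b : ℝ) (hab : a ≤ b) (F : ℕ → ℝ → ℝ) (hF : ∀ k, Continuous (F k)) (M : ℕ → ℝ)
    (hM : Summable M) (hb : ∀ k, ∀ x ∈ Set.Ioc a b, |F k x| ≤ M k) (f : ℝ → ℝ)
    (hf : ∀ x ∈ Set.Ioc a b, HasSum (fun k => F k x) (f x)) :
    HasSum (fun k => ∫ x in a..b, F k x) (∫ x in a..b, f x) := by
  refine intervalIntegral.hasSum_integral_of_dominated_convergence (fun k _ => M k) ?_ ?_ ?_ ?_ ?_
  · intro k; exact (hF k).aestronglyMeasurable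
  · intro k
    refine Filter.Eventually.of_forall fun x hx => ?_
    rw [Set.uIoc_of_le hab] at hx
    exact hb k x hx
  · exact Filter.Eventually.of_forall fun x _ => hM
  · exact intervalIntegrable_const
  · refine Filter.Eventually.of_forall fun x hx => ?_
    rw [Set.uIoc_of_le hab] at hx
    exact hf x hx

theorem momentL (s : ℝ) (hs : 0 < s) (n : ℕ) :
    IntegrableOn (fun r : ℝ => r ^ (2 * n + 1) * Real.exp (-r ^ 2 / s)) (Set.Ioi 0) ∧
    ∫ r in Set.Ioi (0:ℝ), r ^ (2 * n + 1) * Real.exp (-r ^ 2 / s)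
      = (Nat.factorial n : ℝ) * s ^ (n + 1) / 2 := by
  have hb : 0 < 1 / s := by positivity
  have e : ∀ r ∈ Set.Ioi (0:ℝ), r ^ ((2 * n + 1 : ℕ) : ℝ) * Real.exp (-(1 / s) * r ^ (2:ℝ))
      = r ^ (2 * n + 1) * Real.exp (-r ^ 2 / s) := by
    intro r hr
    rw [Real.rpow_natCast, Real.rpow_two]
    congr 2; ring
  constructor
  · refine IntegrableOn.congr_fun (integrableOn_rpow_mul_exp_neg_mul_rpow (p := 2)
      (s := ((2 * n + 1 : ℕ) : ℝ)) ?_ (by norm_num) hb) e measurableSet_Ioi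
    push_cast; have : (0:ℝ) ≤ n := by positivity
    linarith
  · rw [← setIntegral_congr_fun measurableSet_Ioi e]
    rw [integral_rpow_mul_exp_neg_mul_rpow (by norm_num) ?_ hb]
    · have h1 : ((2 * n + 1 : ℕ) + 1 : ℝ) / 2 = n + 1 := by push_cast; ring
      rw [neg_div, h1, Real.Gamma_nat_eq_factorial, one_div, Real.inv_rpow hs.le, Real.rpow_neg hs.le, inv_inv,
        ← Nat.cast_succ, Real.rpow_natCast, Nat.succ_eq_add_one]
      ring
    · push_cast; have : (0:ℝ) ≤ n := by positivity
      linarith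

theorem bndL (s : ℝ) (hs : 0 < s) (l : ℕ) (r : ℝ) (hr : 0 ≤ r) :
    r ^ (2 * l + 1) * Real.exp (-r ^ 2 / s) ≤ r * ((Nat.factorial l : ℝ) * s ^ l) := by
  have h := Real.pow_div_factorial_le_exp (r ^ 2 / s) (by positivity) l
  have hf : (0:ℝ) < Nat.factorial l := by positivity
  rw [div_le_iff₀ hf, div_pow, div_le_iff₀ (by positivity)] at h
  rw [neg_div, Real.exp_neg, ← div_eq_mul_inv, div_le_iff₀ (Real.exp_pos _)]
  calc r ^ (2 * l + 1) = r * (r ^ 2) ^ l := by ring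
    _ ≤ r * (Real.exp (r ^ 2 / s) * (Nat.factorial l : ℝ) * s ^ l) := by gcongr
    _ = _ := by ring

theorem poch_pos' (m : ℝ) (hm : 0 < m) (p : ℕ) : 0 < poch m p :=
  Finset.prod_pos fun j _ => by positivity

theorem pochL (m t : ℝ) (hm : 0 < m) (ht : 1 < t) :
    ∃ C : ℝ, 0 ≤ C ∧ ∀ p : ℕ, poch m p ≤ C * t ^ p * (Nat.factorial p : ℝ) := by
  obtain ⟨N, hN⟩ := exists_nat_ge (m / (t - 1))
  rw [div_le_iff₀ (by linarith)] at hN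
  have key : ∀ p : ℕ, 0 ≤ poch m p / (t ^ p * (Nat.factorial p : ℝ)) := fun p => by
    have := poch_pos' m hm p
    positivity
  refine ⟨∑ p ∈ Finset.range (N + 1), poch m p / (t ^ p * (Nat.factorial p : ℝ)),
    Finset.sum_nonneg fun p _ => key p, ?_⟩
  intro p
  rcases le_total p N with h | h
  · have := Finset.single_le_sum (f := fun p => poch m p / (t ^ p * (Nat.factorial p : ℝ)))
      (fun p _ => key p) (Finset.mem_range.2 (Nat.lt_succ_of_le h))
    rw [div_le_iff₀ (by positivity)] at this
    linarith
  · set C := ∑ p ∈ Finset.range (N + 1), poch m p / (t ^ p * (Nat.factorial p : ℝ)) with hC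
    induction p, h using Nat.le_induction with
    | base =>
      have := Finset.single_le_sum (f := fun p => poch m p / (t ^ p * (Nat.factorial p : ℝ)))
        (fun p _ => key p) (Finset.mem_range.2 (Nat.lt_succ_self N))
      rw [div_le_iff₀ (by positivity)] at this
      linarith
    | succ p hp ih =>
      have h1 : poch m (p + 1) = poch m p * (m + p) := Finset.prod_range_succ _ _
      have hp' : (N:ℝ) ≤ p := by exact_mod_cast hp
      have h2 : m + p ≤ t * (p + 1) := by nlinarith
      rw [h1, Nat.factorial_succ]
      push_cast
      have h0 := poch_pos' m hm p
      calc poch m p * (m + p) ≤ (C * t ^ p * (Nat.factorial p : ℝ)) * (t * (p + 1)) := by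
            gcongr
            exact h0.le.trans ih
        _ = _ := by ring

theorem alpha_nonneg' (σ ρ m K : ℝ) (hσ : 0 < σ) (hρ0 : 0 < ρ) (hρ1 : ρ < 1) (hm : 0 < m)
    (hK : 0 < K) (k i n : ℕ) : 0 ≤ alpha σ ρ m K k i n := by
  have h1 : 0 < 1 - ρ := by linarith
  have h2 := poch_pos' m hm (k - i)
  have h3 : 0 ≤ Real.rpow (m * ρ / (m * ρ + K)) m := Real.rpow_nonneg (by positivity) _
  unfold alpha
  positivity

theorem binL (i : ℕ) (u : ℝ) : ∑ n ∈ Finset.range (i + 1),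
    1 / ((Nat.factorial n : ℝ) * (Nat.factorial (i - n) : ℝ)) * u ^ i
      = (2 * u) ^ i / (Nat.factorial i : ℝ) := by
  rw [← Finset.sum_mul]
  have : ∑ n ∈ Finset.range (i + 1), 1 / ((Nat.factorial n : ℝ) * (Nat.factorial (i - n) : ℝ))
      = 2 ^ i / (Nat.factorial i : ℝ) := by
    rw [eq_div_iff (by positivity), Finset.sum_mul]
    rw [show (2:ℝ) ^ i = ((2 ^ i : ℕ) : ℝ) by push_cast; rfl, ← Nat.sum_range_choose]
    push_cast
    refine Finset.sum_congr rfl fun n hn => ?_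
    rw [Nat.cast_choose ℝ (Nat.lt_succ_iff.1 (Finset.mem_range.1 hn))]
    ring
  rw [this, mul_pow]; ring

theorem majL (σ ρ m K : ℝ) (hσ : 0 < σ) (hρ0 : 0 < ρ) (hρ1 : ρ < 1) (hm : 0 < m) (hK : 0 < K)
    (s : ℝ) (hs : s = σ ^ 2 * (1 - ρ)) :
    Summable (fun k : ℕ => ∑ i ∈ Finset.range (k + 1), ∑ n ∈ Finset.range (i + 1),
      alpha σ ρ m K k i n * ((Nat.factorial n : ℝ) * s ^ (n + 1) / 2) *
        ((Nat.factorial (i - n) : ℝ) * s ^ (i - n))) := by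
  have h1 : 0 < 1 - ρ := by linarith
  have hs0 : 0 < s := by rw [hs]; positivity
  set a := K / (σ ^ 2 * ρ * (ρ * m + K)) with ha
  set b := (1 + ρ) / (σ ^ 2 * ρ * (1 - ρ)) with hb
  set P := 8 * Real.rpow (m * ρ / (m * ρ + K)) m / (σ ^ 6 * ρ * (1 - ρ) ^ 2) with hP
  have ha0 : 0 < a := by positivity
  have hb0 : 0 < b := by positivity
  have hP0 : 0 ≤ P := by
    have h3 : 0 ≤ Real.rpow (m * ρ / (m * ρ + K)) m := Real.rpow_nonneg (by positivity) _
    positivity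
  have hlt : a < b - 2 / s := by
    have e1 : b - 2 / s = 1 / (σ ^ 2 * ρ) := by
      rw [hb, hs]; field_simp; ring
    rw [e1, ha, div_lt_div_iff₀ (by positivity) (by positivity)]
    have : 0 < σ ^ 2 * ρ * (ρ * m) := by positivity
    nlinarith
  have ht : 1 < (b - 2 / s) / a := (one_lt_div ha0).2 hlt
  obtain ⟨t, ht1, ht2⟩ := exists_between ht
  rw [lt_div_iff₀ ha0] at ht2
  obtain ⟨C, hC0, hC⟩ := pochL m t hm ht1
  have hq : (t * a + 2 / s) / b < 1 := by rw [div_lt_one hb0]; linarith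
  have ht0 : 0 < t := by linarith
  have hq0 : 0 ≤ (t * a + 2 / s) / b := by positivity
  refine Summable.of_nonneg_of_le ?_ ?_
    ((summable_geometric_of_lt_one hq0 hq).mul_left (P * s * C / (4 * b)))
  · intro k
    refine Finset.sum_nonneg fun i _ => Finset.sum_nonneg fun n _ => ?_
    have := alpha_nonneg' σ ρ m K hσ hρ0 hρ1 hm hK k i n
    positivity
  · intro k
    have hR : P * s * C / (4 * b) * ((t * a + 2 / s) / b) ^ k =
      ∑ i ∈ Finset.range (k + 1), ∑ n ∈ Finset.range (i + 1),
        P * s * C / (4 * b) * ((t * a) ^ (k - i) * (Nat.factorial k : ℝ) /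
          ((Nat.factorial (k - i) : ℝ) * b ^ k)) *
          (1 / ((Nat.factorial n : ℝ) * (Nat.factorial (i - n) : ℝ)) * (1 / s) ^ i) := by
      simp_rw [← Finset.mul_sum, binL]
      rw [div_pow, add_comm (t * a), add_pow, Finset.sum_div, Finset.mul_sum]
      refine Finset.sum_congr rfl fun i hi => ?_
      rw [Nat.cast_choose ℝ (Nat.lt_succ_iff.1 (Finset.mem_range.1 hi))]
      field_simp
    rw [hR]
    refine Finset.sum_le_sum fun i hi => Finset.sum_le_sum fun n hn => ?_
    have hn' : n ≤ i := Nat.lt_succ_iff.1 (Finset.mem_range.1 hn)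
    obtain ⟨l, rfl⟩ := Nat.exists_eq_add_of_le hn'
    have e : alpha σ ρ m K k (n + l) n * ((Nat.factorial n : ℝ) * s ^ (n + 1) / 2) *
        ((Nat.factorial (n + l - n) : ℝ) * s ^ (n + l - n)) =
        P * s / (4 * b) * (poch m (k - (n + l)) * a ^ (k - (n + l)) * (Nat.factorial k : ℝ) /
          ((Nat.factorial (k - (n + l)) : ℝ) ^ 2 * b ^ k)) *
          (1 / ((Nat.factorial n : ℝ) * (Nat.factorial (n + l - n) : ℝ)) * (1 / s) ^ (n + l)) := by
      unfold alpha
      rw [← hs, ← hP, ← ha, ← hb, Nat.add_sub_cancel_left, one_div_pow]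
      field_simp
      ring
    rw [e]
    have hp := hC (k - (n + l))
    calc _ ≤ P * s / (4 * b) * ((C * t ^ (k - (n + l)) * (Nat.factorial (k - (n + l)) : ℝ)) * a ^ (k - (n + l)) * (Nat.factorial k : ℝ) /
          ((Nat.factorial (k - (n + l)) : ℝ) ^ 2 * b ^ k)) *
          (1 / ((Nat.factorial n : ℝ) * (Nat.factorial (n + l - n) : ℝ)) * (1 / s) ^ (n + l)) := by
          gcongr
      _ = _ := by rw [mul_pow]; field_simp

theorem jL (s x : ℝ) (hs : 0 < s) (hx : 0 ≤ x) (l : ℕ) :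
    HasSum (fun j : ℕ => (-1 : ℝ) ^ j * x ^ (2 * (l + j + 1)) /
        (s ^ j * (Nat.factorial j : ℝ) * (2 * (l + j + 1))))
      (∫ r in (0:ℝ)..x, r ^ (2 * l + 1) * Real.exp (-r ^ 2 / s)) := by
  have H := swapL 0 x hx (fun j r => r ^ (2 * l + 1) * ((-r ^ 2 / s) ^ j / (Nat.factorial j : ℝ)))
    (fun j => by fun_prop) (fun j => x ^ (2 * l + 1) * ((x ^ 2 / s) ^ j / (Nat.factorial j : ℝ)))
    ((Real.summable_pow_div_factorial _).mul_left _) ?_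
    (fun r => r ^ (2 * l + 1) * Real.exp (-r ^ 2 / s)) ?_
  · convert H using 2 with j
    have e : ∀ r : ℝ, r ^ (2 * l + 1) * ((-r ^ 2 / s) ^ j / (Nat.factorial j : ℝ)) =
        ((-1) ^ j / (s ^ j * (Nat.factorial j : ℝ))) * r ^ (2 * (l + j) + 1) := by
      intro r
      rw [div_pow, neg_pow, ← pow_mul]
      field_simp
      ring
    simp_rw [e]
    rw [intervalIntegral.integral_const_mul, integral_pow]
    rw [zero_pow (by omega), show 2 * (l + j) + 1 + 1 = 2 * (l + j + 1) by ring]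
    push_cast
    field_simp
    ring
  · intro j r hr
    have h0 := hr.1.le
    rw [abs_mul, abs_div, abs_pow, abs_pow, abs_div, abs_neg, abs_pow, abs_of_nonneg h0, abs_of_pos hs,
      Nat.abs_cast]
    have := hr.2
    gcongr
  · intro r hr
    refine HasSum.mul_left _ ?_
    rw [Real.exp_eq_exp_ℝ]
    exact NormedSpace.expSeries_div_hasSum_exp _

theorem wL (s Dalt ra lam γ : ℝ) (hs : 0 < s) (hra : 0 < ra) (hγ : 0 < γ) (l : ℕ) :
    HasSum (fun j : ℕ => (-1 : ℝ) ^ j * γ ^ (2 * (l + j + 1)) /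
        (s ^ j * (Nat.factorial j : ℝ) * (2 * (l + j + 1))) * Gbar Dalt ra lam (l + j))
      (∫ w in Real.sqrt (Dalt ^ 2 + lam ^ 2)..Real.sqrt (Dalt ^ 2 + lam ^ 2 + ra ^ 2),
        (2 * w / ra ^ 2) * ∫ r in (0:ℝ)..(γ * w), r ^ (2 * l + 1) * Real.exp (-r ^ 2 / s)) := by
  set A := Real.sqrt (Dalt ^ 2 + lam ^ 2) with hA
  set B := Real.sqrt (Dalt ^ 2 + lam ^ 2 + ra ^ 2) with hB
  have hAB : A ≤ B := Real.sqrt_le_sqrt (by nlinarith)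
  have hA0 : 0 ≤ A := Real.sqrt_nonneg _
  have hA2 : A ^ 2 = Dalt ^ 2 + lam ^ 2 := Real.sq_sqrt (by positivity)
  have hB2 : B ^ 2 = Dalt ^ 2 + lam ^ 2 + ra ^ 2 := Real.sq_sqrt (by positivity)
  have H := swapL A B hAB (fun j w => (2 * w / ra ^ 2) * ((-1 : ℝ) ^ j * (γ * w) ^ (2 * (l + j + 1)) /
        (s ^ j * (Nat.factorial j : ℝ) * (2 * (l + j + 1)))))
    (fun j => by fun_prop)
    (fun j => (2 * B / ra ^ 2) * (γ * B) ^ (2 * l + 2) * (((γ * B) ^ 2 / s) ^ j / (Nat.factorial j : ℝ)))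
    ((Real.summable_pow_div_factorial _).mul_left _) ?_
    (fun w => (2 * w / ra ^ 2) * ∫ r in (0:ℝ)..(γ * w), r ^ (2 * l + 1) * Real.exp (-r ^ 2 / s)) ?_
  · convert H using 2 with j
    have e : ∀ w : ℝ, (2 * w / ra ^ 2) * ((-1 : ℝ) ^ j * (γ * w) ^ (2 * (l + j + 1)) /
        (s ^ j * (Nat.factorial j : ℝ) * (2 * (l + j + 1)))) =
        ((-1 : ℝ) ^ j * γ ^ (2 * (l + j + 1)) /
        (s ^ j * (Nat.factorial j : ℝ) * (2 * (l + j + 1)))) * (2 / ra ^ 2) *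
          w ^ (2 * (l + j + 1) + 1) := by
      intro w
      rw [mul_pow]
      ring
    simp_rw [e]
    rw [intervalIntegral.integral_const_mul, integral_pow]
    rw [show 2 * (l + j + 1) + 1 + 1 = 2 * (l + j + 2) by ring, pow_mul A, pow_mul B, hA2, hB2, mul_assoc _ (2 / ra ^ 2)]
    congr 1
    unfold Gbar
    push_cast
    field_simp
    ring
  · intro j w hw
    have h0 : 0 ≤ w := hA0.trans hw.1.le
    have hwB := hw.2
    have hB0 : 0 ≤ B := h0.trans hwB
    rw [abs_mul, abs_of_nonneg (by positivity : 0 ≤ 2 * w / ra ^ 2), abs_div, abs_mul, abs_pow,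
      abs_neg, abs_one, one_pow, one_mul,
      abs_of_nonneg (by positivity : 0 ≤ (γ * w) ^ (2 * (l + j + 1))),
      abs_of_nonneg (by positivity : 0 ≤ s ^ j * (Nat.factorial j : ℝ) * (2 * (l + j + 1 : ℝ)))]
    calc _ ≤ 2 * B / ra ^ 2 * ((γ * B) ^ (2 * (l + j + 1)) / (s ^ j * (Nat.factorial j : ℝ) * 1)) := by
          gcongr
          have : (0:ℝ) ≤ l := by positivity
          have : (0:ℝ) ≤ j := by positivity
          linarith
      _ = _ := by
          rw [div_pow]
          field_simp
          ring
  · intro w hw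
    exact (jL s (γ * w) hs (mul_nonneg hγ.le (hA0.trans hw.1.le)) l).mul_left _

theorem r1L (σ ρ m K : ℝ) (hσ : 0 < σ) (hρ0 : 0 < ρ) (hρ1 : ρ < 1) (hm : 0 < m) (hK : 0 < K)
    (s : ℝ) (hs : s = σ ^ 2 * (1 - ρ)) (hs0 : 0 < s) (r : ℝ) (hr : 0 ≤ r) :
    HasSum (fun k : ℕ => ∑ i ∈ Finset.range (k + 1), ∑ n ∈ Finset.range (i + 1),
      alpha σ ρ m K k i n * ((Nat.factorial n : ℝ) * s ^ (n + 1) / 2) *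
        (r ^ (2 * (i - n) + 1) * Real.exp (-r ^ 2 / s)))
      (∫ r₁ in Set.Ioi (0 : ℝ), fpdf σ ρ m K r₁ r) := by
  have hα := alpha_nonneg' σ ρ m K hσ hρ0 hρ1 hm hK
  have hmaj := (majL σ ρ m K hσ hρ0 hρ1 hm hK s hs).mul_left r
  set T : ℕ → ℝ → ℝ := fun k r₁ => ∑ i ∈ Finset.range (k + 1), ∑ n ∈ Finset.range (i + 1),
    alpha σ ρ m K k i n * (r ^ (2 * (i - n) + 1) * Real.exp (-r ^ 2 / s)) *
      (r₁ ^ (2 * n + 1) * Real.exp (-r₁ ^ 2 / s)) with hT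
  have hTi : ∀ k, IntegrableOn (T k) (Set.Ioi 0) := fun k =>
    integrable_finsetSum _ fun i _ => integrable_finsetSum _ fun n _ =>
      ((momentL s hs0 n).1).const_mul _
  have hTv : ∀ k, ∫ r₁ in Set.Ioi (0:ℝ), T k r₁ =
      ∑ i ∈ Finset.range (k + 1), ∑ n ∈ Finset.range (i + 1),
      alpha σ ρ m K k i n * ((Nat.factorial n : ℝ) * s ^ (n + 1) / 2) *
        (r ^ (2 * (i - n) + 1) * Real.exp (-r ^ 2 / s)) := by
    intro k
    rw [hT]
    rw [integral_finsetSum _ fun i _ => integrable_finsetSum _ fun n _ =>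
      ((momentL s hs0 n).1).const_mul _]
    refine Finset.sum_congr rfl fun i _ => ?_
    rw [integral_finsetSum _ fun n _ => ((momentL s hs0 n).1).const_mul _]
    refine Finset.sum_congr rfl fun n _ => ?_
    rw [integral_const_mul, (momentL s hs0 n).2]
    ring
  have hf : ∀ r₁, fpdf σ ρ m K r₁ r = ∑' k, T k r₁ := by
    intro r₁
    unfold fpdf
    rw [← hs]
    refine tsum_congr fun k => Finset.sum_congr rfl fun i _ => Finset.sum_congr rfl fun n _ => ?_
    rw [neg_add, add_div, Real.exp_add]
    ring
  simp_rw [hf, ← hTv]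
  refine hasSum_integral_of_summable_integral_norm hTi ?_
  have hn : ∀ k, ∫ r₁ in Set.Ioi (0:ℝ), ‖T k r₁‖ = ∫ r₁ in Set.Ioi (0:ℝ), T k r₁ := by
    intro k
    refine setIntegral_congr_fun measurableSet_Ioi fun r₁ hr₁ => ?_
    have h1 : (0:ℝ) < r₁ := hr₁
    refine Real.norm_of_nonneg ?_
    refine Finset.sum_nonneg fun i _ => Finset.sum_nonneg fun n _ => ?_
    have := hα k i n
    positivity
  simp_rw [hn, hTv]
  refine Summable.of_nonneg_of_le ?_ ?_ hmaj
  · intro k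
    refine Finset.sum_nonneg fun i _ => Finset.sum_nonneg fun n _ => ?_
    have := hα k i n
    positivity
  · intro k
    rw [Finset.mul_sum]
    refine Finset.sum_le_sum fun i _ => ?_
    rw [Finset.mul_sum]
    refine Finset.sum_le_sum fun n _ => ?_
    have := hα k i n
    have h2 := bndL s hs0 (i - n) r hr
    calc _ ≤ alpha σ ρ m K k i n * ((Nat.factorial n : ℝ) * s ^ (n + 1) / 2) *
        (r * ((Nat.factorial (i - n) : ℝ) * s ^ (i - n))) := by gcongr
      _ = _ := by ring

theorem noma_outage_uav2 (σ ρ m K Dalt ra lam γ₂ : ℝ)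
    (hσ : 0 < σ) (hρ0 : 0 < ρ) (hρ1 : ρ < 1) (hm : 0 < m) (hK : 0 < K)
    (hD : 0 < Dalt) (hra : 0 < ra) (hlam : 0 < lam) (hγ₂ : 0 < γ₂) :
    Summable (fun k : ℕ => ∑ i ∈ Finset.range (k + 1), ∑ n ∈ Finset.range (i + 1),
      ∑' j : ℕ, alpha σ ρ m K k i n * Gfun σ ρ j (i - n) n γ₂ *
        Gbar Dalt ra lam (i - n + j)) ∧
    (∫ w in Real.sqrt (Dalt ^ 2 + lam ^ 2)..Real.sqrt (Dalt ^ 2 + lam ^ 2 + ra ^ 2),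
        (2 * w / ra ^ 2) *
          ∫ r₂ in (0 : ℝ)..(γ₂ * w), ∫ r₁ in Set.Ioi (0 : ℝ), fpdf σ ρ m K r₁ r₂) =
      ∑' k : ℕ, ∑ i ∈ Finset.range (k + 1), ∑ n ∈ Finset.range (i + 1),
        ∑' j : ℕ, alpha σ ρ m K k i n * Gfun σ ρ j (i - n) n γ₂ *
          Gbar Dalt ra lam (i - n + j) := by
  have h1 : 0 < 1 - ρ := by linarith
  obtain ⟨s, hs⟩ : ∃ s, s = σ ^ 2 * (1 - ρ) := ⟨_, rfl⟩
  have hs0 : 0 < s := by rw [hs]; positivity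
  have hα := alpha_nonneg' σ ρ m K hσ hρ0 hρ1 hm hK
  have hmaj := majL σ ρ m K hσ hρ0 hρ1 hm hK s hs
  set A := Real.sqrt (Dalt ^ 2 + lam ^ 2) with hA
  set B := Real.sqrt (Dalt ^ 2 + lam ^ 2 + ra ^ 2) with hB
  have hAB : A ≤ B := Real.sqrt_le_sqrt (by nlinarith)
  have hA0 : 0 ≤ A := Real.sqrt_nonneg _
  set M : ℕ → ℝ := fun k => ∑ i ∈ Finset.range (k + 1), ∑ n ∈ Finset.range (i + 1),
      alpha σ ρ m K k i n * ((Nat.factorial n : ℝ) * s ^ (n + 1) / 2) *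
        ((Nat.factorial (i - n) : ℝ) * s ^ (i - n)) with hM
  set U : ℕ → ℝ → ℝ := fun k r => ∑ i ∈ Finset.range (k + 1), ∑ n ∈ Finset.range (i + 1),
      alpha σ ρ m K k i n * ((Nat.factorial n : ℝ) * s ^ (n + 1) / 2) *
        (r ^ (2 * (i - n) + 1) * Real.exp (-r ^ 2 / s)) with hU
  have hUc : ∀ k, Continuous (U k) := fun k => by rw [hU]; fun_prop
  have hM0 : ∀ k, 0 ≤ M k := by
    intro k
    refine Finset.sum_nonneg fun i _ => Finset.sum_nonneg fun n _ => ?_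
    have := hα k i n
    positivity
  have hU0 : ∀ k r, 0 ≤ r → 0 ≤ U k r := by
    intro k r hr
    refine Finset.sum_nonneg fun i _ => Finset.sum_nonneg fun n _ => ?_
    have := hα k i n
    positivity
  have hUb : ∀ k r, 0 ≤ r → U k r ≤ r * M k := by
    intro k r hr
    rw [hM, Finset.mul_sum]
    refine Finset.sum_le_sum fun i _ => ?_
    rw [Finset.mul_sum]
    refine Finset.sum_le_sum fun n _ => ?_
    have := hα k i n
    have h2 := bndL s hs0 (i - n) r hr
    calc _ ≤ alpha σ ρ m K k i n * ((Nat.factorial n : ℝ) * s ^ (n + 1) / 2) *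
        (r * ((Nat.factorial (i - n) : ℝ) * s ^ (i - n))) := by gcongr
      _ = _ := by ring
  have hV : ∀ w, 0 ≤ w → HasSum (fun k => ∫ r in (0:ℝ)..(γ₂ * w), U k r)
      (∫ r₂ in (0 : ℝ)..(γ₂ * w), ∫ r₁ in Set.Ioi (0 : ℝ), fpdf σ ρ m K r₁ r₂) := by
    intro w hw
    refine swapL 0 (γ₂ * w) (by positivity) U hUc (fun k => (γ₂ * w) * M k) (hmaj.mul_left _) ?_ _ ?_
    · intro k r hr
      rw [abs_of_nonneg (hU0 k r hr.1.le)]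
      exact (hUb k r hr.1.le).trans (mul_le_mul_of_nonneg_right hr.2 (hM0 k))
    · intro r hr
      exact r1L σ ρ m K hσ hρ0 hρ1 hm hK s hs hs0 r hr.1.le
  have hVc : ∀ k, Continuous (fun w => ∫ r in (0:ℝ)..(γ₂ * w), U k r) := fun k =>
    (intervalIntegral.continuous_primitive (fun a b => (hUc k).intervalIntegrable a b) 0).comp
      (continuous_const.mul continuous_id)
  have hW := swapL A B hAB (fun k w => (2 * w / ra ^ 2) * ∫ r in (0:ℝ)..(γ₂ * w), U k r)
    (fun k => ((continuous_const.mul continuous_id).div_const _).mul (hVc k))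
    (fun k => (2 * B / ra ^ 2) * ((γ₂ * B) * (γ₂ * B)) * M k) (hmaj.mul_left _) (by
      intro k w hw
      have h0 : 0 ≤ w := hA0.trans hw.1.le
      have hwB := hw.2
      have hB0 : 0 ≤ B := h0.trans hwB
      have hMk := hM0 k
      have hb : ‖∫ r in (0:ℝ)..(γ₂ * w), U k r‖ ≤ (γ₂ * w * M k) * |γ₂ * w - 0| := by
        refine intervalIntegral.norm_integral_le_of_norm_le_const fun r hr => ?_
        rw [Set.uIoc_of_le (by positivity)] at hr
        rw [Real.norm_of_nonneg (hU0 k r hr.1.le)]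
        exact (hUb k r hr.1.le).trans (mul_le_mul_of_nonneg_right hr.2 (hM0 k))
      rw [sub_zero, abs_of_nonneg (by positivity : 0 ≤ γ₂ * w), Real.norm_eq_abs] at hb
      rw [abs_mul, abs_of_nonneg (by positivity : 0 ≤ 2 * w / ra ^ 2)]
      calc _ ≤ 2 * w / ra ^ 2 * (γ₂ * w * M k * (γ₂ * w)) := by gcongr
        _ ≤ 2 * B / ra ^ 2 * (γ₂ * B * M k * (γ₂ * B)) := by gcongr
        _ = _ := by ring)
    (fun w => (2 * w / ra ^ 2) *
      ∫ r₂ in (0 : ℝ)..(γ₂ * w), ∫ r₁ in Set.Ioi (0 : ℝ), fpdf σ ρ m K r₁ r₂)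
    (fun w hw => (hV w (hA0.trans hw.1.le)).mul_left _)
  have hfin : ∀ k, (∫ w in A..B, (2 * w / ra ^ 2) * ∫ r in (0:ℝ)..(γ₂ * w), U k r) =
      ∑ i ∈ Finset.range (k + 1), ∑ n ∈ Finset.range (i + 1),
      ∑' j : ℕ, alpha σ ρ m K k i n * Gfun σ ρ j (i - n) n γ₂ *
        Gbar Dalt ra lam (i - n + j) := by
    intro k
    have hgc : ∀ l : ℕ, Continuous (fun r : ℝ => r ^ (2 * l + 1) * Real.exp (-r ^ 2 / s)) :=
      fun l => by fun_prop
    have hIc : ∀ l : ℕ, Continuous (fun w : ℝ => (2 * w / ra ^ 2) *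
        ∫ r in (0:ℝ)..(γ₂ * w), r ^ (2 * l + 1) * Real.exp (-r ^ 2 / s)) := fun l =>
      ((continuous_const.mul continuous_id).div_const _).mul
      ((intervalIntegral.continuous_primitive (fun a b => (hgc l).intervalIntegrable a b) 0).comp
        (continuous_const.mul continuous_id))
    have e : ∀ w, (2 * w / ra ^ 2) * ∫ r in (0:ℝ)..(γ₂ * w), U k r =
        ∑ i ∈ Finset.range (k + 1), ∑ n ∈ Finset.range (i + 1),
          alpha σ ρ m K k i n * ((Nat.factorial n : ℝ) * s ^ (n + 1) / 2) * ((2 * w / ra ^ 2) *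
        ∫ r in (0:ℝ)..(γ₂ * w), r ^ (2 * (i - n) + 1) * Real.exp (-r ^ 2 / s)) := by
      intro w
      rw [hU]
      rw [intervalIntegral.integral_finsetSum
        (fun i _ => Continuous.intervalIntegrable (by fun_prop) _ _), Finset.mul_sum]
      refine Finset.sum_congr rfl fun i _ => ?_
      rw [intervalIntegral.integral_finsetSum
        (fun i _ => Continuous.intervalIntegrable (by fun_prop) _ _), Finset.mul_sum]
      refine Finset.sum_congr rfl fun n _ => ?_
      rw [intervalIntegral.integral_const_mul]
      ring
    simp_rw [e]
    have hc : ∀ (c : ℝ) (l : ℕ), Continuous (fun w : ℝ => c * ((2 * w / ra ^ 2) *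
        ∫ r in (0:ℝ)..(γ₂ * w), r ^ (2 * l + 1) * Real.exp (-r ^ 2 / s))) :=
      fun c l => continuous_const.mul (hIc l)
    rw [intervalIntegral.integral_finsetSum]
    swap
    · intro i _
      exact Continuous.intervalIntegrable (continuous_finsetSum _ fun n _ => hc _ _) _ _
    refine Finset.sum_congr rfl fun i _ => ?_
    rw [intervalIntegral.integral_finsetSum]
    swap
    · intro n _
      exact Continuous.intervalIntegrable (hc _ _) _ _
    refine Finset.sum_congr rfl fun n _ => ?_
    rw [intervalIntegral.integral_const_mul]
    refine (HasSum.tsum_eq ?_).symm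
    have H := (wL s Dalt ra lam γ₂ hs0 hra hγ₂ (i - n)).mul_left
      (alpha σ ρ m K k i n * ((Nat.factorial n : ℝ) * s ^ (n + 1) / 2))
    refine Eq.mpr (congrArg (fun g : ℕ → ℝ => HasSum g _) (funext fun j => ?_)) H
    unfold Gfun
    rw [← hs, zpow_sub₀ hs0.ne', zpow_natCast, ← Nat.cast_succ, zpow_natCast, Nat.succ_eq_add_one]
    field_simp
    ring
  simp_rw [hfin] at hW
  exact ⟨hW.summable, hW.tsum_eq.symm⟩
end
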